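/- For all real numbers a, b, c and all nonnegative integers p, q, i, j, k, l, the planar polynomial system (ẋ, ẏ) = ( a x^p y^q, b x^i y^j + c x^k y^l ) has no limit cycle. -/

import Mathlib

open Real Set

noncomputable section

/-- `φ` is a solution of the planar ODE `(ẋ,ẏ) = X(x,y)`. -/
def IsSolution (X : ℝ × ℝ → ℝ × ℝ) (φ : ℝ → ℝ × ℝ) : Prop :=
  ∀ t : ℝ, HasDerivAt φ (X (φ t)) t

/-- `φ` is a (non-constant) periodic orbit of the system `(ẋ,ẏ) = X(x,y)`. -/
def IsPeriodicOrbit (X : ℝ × ℝ → ℝ × ℝ) (φ : ℝ → ℝ × ℝ) : Prop :=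
  IsSolution X φ ∧ (∃ T > 0, Function.Periodic φ T) ∧ ¬ (∃ c, ∀ t, φ t = c)

/-- A limit cycle is a periodic orbit that is isolated in the set of all periodic
orbits: it has an open neighbourhood containing no other periodic orbit. -/
def IsLimitCycle (X : ℝ × ℝ → ℝ × ℝ) (φ : ℝ → ℝ × ℝ) : Prop :=
  IsPeriodicOrbit X φ ∧
  ∃ U : Set (ℝ × ℝ), IsOpen U ∧ Set.range φ ⊆ U ∧
    ∀ ψ : ℝ → ℝ × ℝ, IsPeriodicOrbit X ψ → Set.range ψ ⊆ U →
      Set.range ψ = Set.range φ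

/-- The system `(ẋ,ẏ) = X(x,y)` has at least `N` (pairwise distinct) limit cycles. -/
def HasAtLeastNLimitCycles (X : ℝ × ℝ → ℝ × ℝ) (N : ℕ) : Prop :=
  ∃ φ : Fin N → ℝ → ℝ × ℝ, (∀ i, IsLimitCycle X (φ i)) ∧
    ∀ i j, i ≠ j → Set.range (φ i) ≠ Set.range (φ j)

open Filter Topology Metric

lemma sol_unique {Y : ℝ × ℝ → ℝ × ℝ} {K : NNReal} (hY : LipschitzWith K Y) {φ ψ : ℝ → ℝ × ℝ}
    (hφ : IsSolution Y φ) (hψ : IsSolution Y ψ) (t0 : ℝ) (h : φ t0 = ψ t0) : φ = ψ :=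
  ODE_solution_unique_univ (v := fun _ => Y) (s := fun _ => Set.univ) (K := K) (t₀ := t0)
    (fun _ => hY.lipschitzOnWith) (fun t => ⟨hφ t, trivial⟩) (fun t => ⟨hψ t, trivial⟩) h

lemma sol_shift {Y : ℝ × ℝ → ℝ × ℝ} {φ : ℝ → ℝ × ℝ} (hφ : IsSolution Y φ) (s : ℝ) :
    IsSolution Y (fun t => φ (t + s)) := fun t => (hφ (t + s)).comp_add_const t s

lemma sol_exists {Y : ℝ × ℝ → ℝ × ℝ} {K : NNReal} (hY : LipschitzWith K Y) {C : ℝ}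
    (hC : ∀ z, ‖Y z‖ ≤ C) (z : ℝ × ℝ) : ∃ ψ, IsSolution Y ψ ∧ ψ 0 = z := by
  have hC0 : 0 ≤ C := (norm_nonneg _).trans (hC 0)
  have key : ∀ n : ℕ, ∃ α : ℝ → ℝ × ℝ, α 0 = z ∧
      ∀ t ∈ Set.Icc (-((n : ℝ) + 1)) ((n : ℝ) + 1),
        HasDerivWithinAt α (Y (α t)) (Set.Icc (-((n : ℝ) + 1)) ((n : ℝ) + 1)) t := by
    intro n
    have h0 : (0 : ℝ) ∈ Set.Icc (-((n : ℝ) + 1)) ((n : ℝ) + 1) := by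
      constructor <;> linarith [n.cast_nonneg (α := ℝ)]
    have hpl : IsPicardLindelof (fun _ => Y) (⟨0, h0⟩ : Set.Icc (-((n : ℝ) + 1)) ((n : ℝ) + 1))
        z (⟨C, hC0⟩ * ((n : NNReal) + 1)) 0 ⟨C, hC0⟩ K := by
      refine ⟨fun _ _ => hY.lipschitzOnWith, fun _ _ => continuousOn_const, fun _ _ x _ => hC x, ?_⟩
      simp only [sub_zero, zero_sub, neg_neg, max_self, NNReal.coe_zero]
      exact le_of_eq rfl
    obtain ⟨α, h1, h2⟩ := hpl.exists_eq_forall_mem_Icc_hasDerivWithinAt₀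
    exact ⟨α, h1, h2⟩
  choose α hα0 hα using key
  have hα' : ∀ n : ℕ, ∀ t ∈ Set.Ioo (-((n : ℝ) + 1)) ((n : ℝ) + 1),
      HasDerivAt (α n) (Y (α n t)) t := fun n t ht =>
    (hα n t (Set.Ioo_subset_Icc_self ht)).hasDerivAt (Icc_mem_nhds ht.1 ht.2)
  have heq : ∀ n m : ℕ, n ≤ m → ∀ t : ℝ, |t| < n + 1 → α n t = α m t := by
    intro n m hnm t ht
    have hnm' : (n : ℝ) ≤ m := by exact_mod_cast hnm
    have h0 : (0 : ℝ) ∈ Set.Ioo (-((n : ℝ) + 1)) ((n : ℝ) + 1) := by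
      constructor <;> linarith [n.cast_nonneg (α := ℝ)]
    refine ODE_solution_unique_of_mem_Ioo (v := fun _ => Y) (s := fun _ => Set.univ) (K := K)
      (fun _ _ => hY.lipschitzOnWith) h0 (fun t ht => ⟨hα' n t ht, trivial⟩)
      (fun t ht => ⟨hα' m t ⟨by linarith [ht.1], by linarith [ht.2]⟩, trivial⟩)
      (by rw [hα0, hα0]) (abs_lt.1 ht)
  have heq2 : ∀ n : ℕ, ∀ t : ℝ, |t| < n + 1 → α ⌈|t|⌉₊ t = α n t := by
    intro n t ht
    have hm : |t| < (⌈|t|⌉₊ : ℝ) + 1 := by linarith [Nat.le_ceil |t|]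
    rcases le_total n ⌈|t|⌉₊ with h | h
    · exact (heq _ _ h t ht).symm
    · exact heq _ _ h t hm
  refine ⟨fun t => α ⌈|t|⌉₊ t, fun t => ?_, hα0 _⟩
  have hm : |t| < (⌈|t|⌉₊ : ℝ) + 1 := by linarith [Nat.le_ceil |t|]
  refine (hα' ⌈|t|⌉₊ t (abs_lt.1 hm)).congr_of_eventuallyEq ?_
  have : ∀ᶠ s : ℝ in 𝓝 t, |s| < (⌈|t|⌉₊ : ℝ) + 1 :=
    continuous_abs.continuousAt.eventually_lt continuousAt_const hm
  filter_upwards [this] with s hs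
  exact heq2 _ s hs

lemma sol_symm {Y : ℝ × ℝ → ℝ × ℝ} {K : NNReal} (hY : LipschitzWith K Y)
    (R : (ℝ × ℝ) →L[ℝ] (ℝ × ℝ)) (hrev : ∀ z, Y (R z) = - R (Y z))
    {ψ : ℝ → ℝ × ℝ} (hψ : IsSolution Y ψ) (h0 : R (ψ 0) = ψ 0) (t : ℝ) :
    ψ (-t) = R (ψ t) := by
  have h1 : IsSolution Y (fun t => R (ψ (-t))) := by
    intro t
    have h := (hψ (-t)).scomp t (hasDerivAt_neg t)
    have h2 := R.hasFDerivAt.comp_hasDerivAt t h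
    simp only [hrev]
    simpa [Function.comp_def] using h2
  have h2 := sol_unique hY h1 hψ 0 (by simpa using h0)
  have h3 := congrFun h2 (-t)
  simpa using h3.symm

lemma cross {g : ℝ → ℝ} {d s0 : ℝ} (hd : d ≠ 0) (hg : HasDerivAt g d s0) (h0 : g s0 = 0)
    (hs : 0 < s0) : ∃ s1 s2, 0 < s1 ∧ s1 < s0 ∧ s0 < s2 ∧ g s1 * g s2 < 0 := by
  have h1 : Tendsto (slope g s0) (𝓝[≠] s0) (𝓝 d) := hasDerivAt_iff_tendsto_slope.1 hg
  have h2 : ∀ᶠ s in 𝓝[≠] s0, 0 < slope g s0 s * d := by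
    have := h1.mul_const d
    exact this.eventually (lt_mem_nhds (mul_self_pos.2 hd))
  have hl : ∀ᶠ s in 𝓝[<] s0, 0 < slope g s0 s * d :=
    h2.filter_mono (nhdsWithin_mono _ fun x hx => ne_of_lt hx)
  have hr : ∀ᶠ s in 𝓝[>] s0, 0 < slope g s0 s * d :=
    h2.filter_mono (nhdsWithin_mono _ fun x hx => ne_of_gt hx)
  have hl0 : ∀ᶠ s in 𝓝[<] s0, 0 < s := (lt_mem_nhds hs).filter_mono nhdsWithin_le_nhds
  obtain ⟨s1, ⟨h11, h12⟩, h13⟩ := ((hl.and hl0).and self_mem_nhdsWithin).exists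
  obtain ⟨s2, h21, h22⟩ := (hr.and self_mem_nhdsWithin).exists
  have h13 : s1 < s0 := h13
  have h22 : s0 < s2 := h22
  refine ⟨s1, s2, h12, h13, h22, ?_⟩
  rw [slope_def_field, h0, sub_zero] at h11 h21
  have e1 : g s1 * d < 0 := by
    have := mul_neg_of_pos_of_neg h11 (sub_neg.2 h13)
    have hne : s1 - s0 ≠ 0 := (sub_neg.2 h13).ne
    field_simp at this
    exact this
  have e2 : 0 < g s2 * d := by
    have := mul_pos h21 (sub_pos.2 h22)
    have hne : s2 - s0 ≠ 0 := (sub_pos.2 h22).ne'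
    field_simp at this
    exact this
  have := mul_neg_of_neg_of_pos e1 e2
  by_contra hcon
  push Not at hcon
  nlinarith [mul_nonneg hcon (sq_nonneg d)]

lemma rev_lip {Y : ℝ × ℝ → ℝ × ℝ} {K : NNReal} (hY : LipschitzWith K Y) {C : ℝ}
    (hC : ∀ z, ‖Y z‖ ≤ C)
    (R : (ℝ × ℝ) →L[ℝ] (ℝ × ℝ)) (hn : ∀ z, ‖R z‖ = ‖z‖) (hrev : ∀ z, Y (R z) = - R (Y z))
    (ℓ : (ℝ × ℝ) →L[ℝ] ℝ) (hℓ : ∀ z, ℓ z = 0 ↔ R z = z)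
    {φ : ℝ → ℝ × ℝ} (hφ : IsSolution Y φ) {T : ℝ} (hT : 0 < T) (hper : Function.Periodic φ T)
    (h0 : R (φ 0) = φ 0) (hne : ∀ t, Y (φ t) ≠ 0) {ε : ℝ} (hε : 0 < ε) :
    ∃ δ > 0, ∀ z, R z = z → dist z (φ 0) < δ → ∃ ψ, IsSolution Y ψ ∧ ψ 0 = z ∧
      (∃ S > 0, Function.Periodic ψ S) ∧ ∀ t, ∃ s, dist (ψ t) (φ s) < ε := by
  have hsym := sol_symm hY R hrev hφ h0
  have hs0 : R (φ (T / 2)) = φ (T / 2) := by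
    rw [← hsym, ← hper (-(T / 2))]; congr 1; ring
  have hd : ℓ (Y (φ (T / 2))) ≠ 0 := by
    intro h
    have h1 := (hℓ _).1 h
    have h2 := hrev (φ (T / 2))
    rw [hs0, h1] at h2
    have h3 : (2 : ℝ) • Y (φ (T / 2)) = 0 := by
      rw [two_smul]; nth_rewrite 1 [h2]; simp
    exact hne _ ((smul_eq_zero.1 h3).resolve_left two_ne_zero)
  have hder : ∀ {ψ : ℝ → ℝ × ℝ}, IsSolution Y ψ → ∀ t, HasDerivAt (fun t => ℓ (ψ t)) (ℓ (Y (ψ t))) t :=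
    fun h t => ℓ.hasFDerivAt.comp_hasDerivAt t (h t)
  obtain ⟨s1, s2, hs1, hs10, hs02, hneg⟩ := cross hd (hder hφ _) ((hℓ _).2 hs0) (half_pos hT)
  have hev : ∀ s, ℓ (φ s) ≠ 0 → ∃ η > 0, ∀ w, dist w (φ s) < η → 0 < ℓ w * ℓ (φ s) := by
    intro s hs
    have : ∀ᶠ w in 𝓝 (φ s), 0 < ℓ w * ℓ (φ s) := by
      have hc : Continuous fun w => ℓ w * ℓ (φ s) := ℓ.continuous.mul continuous_const
      exact hc.continuousAt.eventually (lt_mem_nhds (mul_self_pos.2 hs))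
    exact Metric.eventually_nhds_iff.1 this
  have hn1 : ℓ (φ s1) ≠ 0 := by intro h; simp [h] at hneg
  have hn2 : ℓ (φ s2) ≠ 0 := by intro h; simp [h] at hneg
  obtain ⟨η1, hη1, H1⟩ := hev s1 hn1
  obtain ⟨η2, hη2, H2⟩ := hev s2 hn2
  set η := min ε (min η1 η2) with hη
  have hηpos : 0 < η := lt_min hε (lt_min hη1 hη2)
  refine ⟨η * Real.exp (-(K * s2)), by positivity, fun z hz hzd => ?_⟩
  obtain ⟨ψ, hψ, hψ0⟩ := sol_exists hY hC z
  have hclose : ∀ t ∈ Set.Icc 0 s2, dist (ψ t) (φ t) < η := by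
    intro t ht
    have hg := dist_le_of_trajectories_ODE (v := fun _ => Y) (K := K) (a := 0) (b := s2)
      (f := ψ) (g := φ) (δ := dist z (φ 0))
      (fun _ => hY) (HasDerivAt.continuousOn fun t _ => hψ t) (fun t _ => (hψ t).hasDerivWithinAt)
      (HasDerivAt.continuousOn fun t _ => hφ t) (fun t _ => (hφ t).hasDerivWithinAt)
      (by rw [hψ0]) t ht
    calc dist (ψ t) (φ t) ≤ dist z (φ 0) * Real.exp (K * (t - 0)) := hg
      _ ≤ dist z (φ 0) * Real.exp (K * s2) := by
        gcongr; linarith [ht.2]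
      _ < η * Real.exp (-(K * s2)) * Real.exp (K * s2) := by gcongr
      _ = η := by rw [mul_assoc, ← Real.exp_add]; simp
  have c1 := H1 _ ((hclose s1 ⟨hs1.le, by linarith⟩).trans_le ((min_le_right _ _).trans (min_le_left _ _)))
  have c2 := H2 _ ((hclose s2 ⟨by linarith, le_rfl⟩).trans_le ((min_le_right _ _).trans (min_le_right _ _)))
  have hcont : ContinuousOn (fun t => ℓ (ψ t)) (Set.uIcc s1 s2) :=
    HasDerivAt.continuousOn fun t _ => hder hψ t
  have hz0 : (0 : ℝ) ∈ Set.uIcc (ℓ (ψ s1)) (ℓ (ψ s2)) := by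
    rw [Set.mem_uIcc]
    rcases lt_or_gt_of_ne hn1 with h | h
    · left
      have : 0 < ℓ (φ s2) := by nlinarith
      constructor <;> by_contra! <;> nlinarith
    · right
      have : ℓ (φ s2) < 0 := by nlinarith
      constructor <;> by_contra! <;> nlinarith
  obtain ⟨σ, hσ, hσ0⟩ := intermediate_value_uIcc hcont hz0
  rw [Set.uIcc_of_le (by linarith)] at hσ
  have hσpos : 0 < σ := lt_of_lt_of_le hs1 hσ.1
  have hRσ := (hℓ _).1 hσ0
  have hsymψ := sol_symm hY R hrev hψ (by rw [hψ0, hz])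
  have hperψ : Function.Periodic ψ (2 * σ) := by
    have := sol_unique hY (sol_shift hψ (2 * σ)) hψ (-σ)
      (by show ψ (-σ + 2 * σ) = ψ (-σ); rw [hsymψ, hRσ]; congr 1; ring)
    exact fun t => congrFun this t
  refine ⟨ψ, hψ, hψ0, ⟨2 * σ, by positivity, hperψ⟩, fun t => ?_⟩
  obtain ⟨t', ht', he⟩ := hperψ.exists_mem_Ico (by positivity : 0 < 2 * σ) t (-σ)
  rw [he]
  refine ⟨t', ?_⟩
  refine lt_of_lt_of_le ?_ (min_le_left ε (min η1 η2))
  rcases le_total 0 t' with h | h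
  · exact hclose t' ⟨h, by linarith [ht'.2, hσ.2]⟩
  · have := hclose (-t') ⟨by linarith, by linarith [ht'.1, hσ.2]⟩
    have e1 := hsymψ (-t')
    have e2 := hsym (-t')
    rw [neg_neg] at e1 e2
    rwa [e1, e2, dist_eq_norm, ← map_sub, hn, ← dist_eq_norm]

lemma cutoff {X : ℝ × ℝ → ℝ × ℝ} (hX : ContDiff ℝ 1 X) (R : (ℝ × ℝ) →L[ℝ] (ℝ × ℝ))
    (hRR : ∀ z, R (R z) = z) (hn : ∀ z, ‖R z‖ = ‖z‖) {M : ℝ} (hM : 0 < M) :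
    ∃ (Y : ℝ × ℝ → ℝ × ℝ) (K : NNReal) (C : ℝ), LipschitzWith K Y ∧ (∀ z, ‖Y z‖ ≤ C) ∧
      (∀ z, ‖z‖ ≤ M → Y z = X z) ∧
      ((∀ z, X (R z) = - R (X z)) → ∀ z, Y (R z) = - R (Y z)) := by
  let f : ContDiffBump (0 : ℝ × ℝ) := ⟨M, M + 1, hM, by linarith⟩
  have hf : ContDiff ℝ 1 f := f.contDiff
  have hYd : ContDiff ℝ 1 (fun z => (f z * f (R z)) • X z) :=
    (hf.mul (hf.comp R.contDiff)).smul hX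
  have hYs : HasCompactSupport (fun z => (f z * f (R z)) • X z) :=
    (f.hasCompactSupport.mul_right (f' := fun z => f (R z))).smul_right
  obtain ⟨K, hK⟩ := ContDiff.lipschitzWith_of_hasCompactSupport hYs hYd one_ne_zero
  obtain ⟨C, hC⟩ := hYd.continuous.bounded_above_of_compact_support hYs
  refine ⟨_, K, C, hK, hC, fun z hz => ?_, fun hrev z => ?_⟩
  · have h1 : f z = 1 := f.one_of_mem_closedBall (by simpa [f] using hz)
    have h2 : f (R z) = 1 := f.one_of_mem_closedBall (by simpa [f, hn] using hz)
    simp [h1, h2]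
  · simp only [hRR, hrev, map_smul, smul_neg, mul_comm]

lemma orbit_cont {X : ℝ × ℝ → ℝ × ℝ} {φ : ℝ → ℝ × ℝ} (h : IsSolution X φ) : Continuous φ :=
  continuous_iff_continuousAt.2 fun t => (h t).continuousAt

lemma orbit_bdd {X : ℝ × ℝ → ℝ × ℝ} {φ : ℝ → ℝ × ℝ} (h : IsPeriodicOrbit X φ) :
    ∃ M > 0, ∀ t, ‖φ t‖ + 1 ≤ M := by
  obtain ⟨hs, ⟨T, hT, hper⟩, -⟩ := h
  obtain ⟨C, hC⟩ := (hper.isBounded_of_continuous hT.ne' (orbit_cont hs)).exists_norm_le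
  have h1 : ∀ t, ‖φ t‖ ≤ C := fun t => hC _ ⟨t, rfl⟩
  exact ⟨C + 1, by linarith [h1 0, norm_nonneg (φ 0)], fun t => by linarith [h1 t]⟩

lemma orbit_ne {X : ℝ × ℝ → ℝ × ℝ} (hX : ContDiff ℝ 1 X) {φ : ℝ → ℝ × ℝ}
    (h : IsPeriodicOrbit X φ) (t : ℝ) : X (φ t) ≠ 0 := by
  intro h0
  obtain ⟨M, hM, hb⟩ := orbit_bdd h
  obtain ⟨Y, K, C, hK, -, hYX, -⟩ := cutoff hX (ContinuousLinearMap.id ℝ _) (fun _ => rfl)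
    (fun _ => rfl) hM
  have h1 : IsSolution Y φ := fun s => by
    rw [hYX _ (by linarith [hb s])]; exact h.1 s
  have h2 : IsSolution Y (fun _ => φ t) := fun s => by
    rw [hYX _ (by linarith [hb t]), h0]; exact hasDerivAt_const _ _
  have h3 := sol_unique hK h1 h2 t rfl
  exact h.2.2 ⟨φ t, fun s => congrFun h3 s⟩

lemma rev_not_limit {X : ℝ × ℝ → ℝ × ℝ} (hX : ContDiff ℝ 1 X)
    (R : (ℝ × ℝ) →L[ℝ] (ℝ × ℝ)) (hRR : ∀ z, R (R z) = z) (hn : ∀ z, ‖R z‖ = ‖z‖)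
    (hrev : ∀ z, X (R z) = - R (X z))
    (ℓ : (ℝ × ℝ) →L[ℝ] ℝ) (hℓ : ∀ z, ℓ z = 0 ↔ R z = z) (e : ℝ × ℝ) (he : e ≠ 0) (hRe : R e = e)
    {φ : ℝ → ℝ × ℝ} (hφ : IsLimitCycle X φ) (t0 : ℝ) (h0 : R (φ t0) = φ t0) : False := by
  obtain ⟨hpo, U, hU, hUφ, hiso⟩ := hφ
  have hne := orbit_ne hX hpo
  obtain ⟨M, hM, hb⟩ := orbit_bdd hpo
  obtain ⟨hs, ⟨T, hT, hper⟩, hnc⟩ := hpo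
  obtain ⟨Y, K, C, hK, hC, hYX, hYrev⟩ := cutoff hX R hRR hn hM
  have hYφ : ∀ s, Y (φ s) = X (φ s) := fun s => hYX _ (by linarith [hb s])
  have hsY : IsSolution Y φ := fun s => by rw [hYφ]; exact hs s
  have hcpt : IsCompact (Set.range φ) := hper.compact_of_continuous hT.ne' (orbit_cont hs)
  obtain ⟨ε, hε, hεU⟩ := hcpt.exists_thickening_subset_open hU hUφ
  obtain ⟨δ, hδ, H⟩ := rev_lip hK hC R hn (hYrev hrev) ℓ hℓ (sol_shift hsY t0) hT
    (fun t => by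
      show φ (t + T + t0) = φ (t + t0)
      rw [← hper (t + t0)]; congr 1; ring) (by simpa using h0)
    (fun t => by rw [hYφ]; exact hne _) (ε := min ε 1) (lt_min hε one_pos)
  simp only [zero_add] at H
  have hfin : {z ∈ Set.range φ | R z = z}.Finite := by
    have hfin1 : {t ∈ Set.Icc 0 T | ℓ (φ t) = 0}.Finite := by
      by_contra hinf
      obtain ⟨x, -, hx⟩ := Set.Infinite.exists_accPt_of_subset_isCompact hinf isCompact_Icc
        (Set.sep_subset _ _)
      rw [accPt_iff_frequently] at hx
      have hdx : HasDerivAt (fun t => ℓ (φ t)) (ℓ (X (φ x))) x :=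
        ℓ.hasFDerivAt.comp_hasDerivAt x (hs x)
      have hx0 : ℓ (φ x) = 0 := by
        by_contra hcon
        have : ∀ᶠ t in 𝓝 x, ℓ (φ t) ≠ 0 := hdx.continuousAt.eventually_ne hcon
        obtain ⟨y, hy1, hy2⟩ := (hx.and_eventually this).exists
        exact hy2 hy1.2.2
      have hRx := (hℓ _).1 hx0
      have hd : ℓ (X (φ x)) ≠ 0 := by
        intro h
        have h1 := (hℓ _).1 h
        have h2 := hrev (φ x)
        rw [hRx, h1] at h2
        have h3 : (2 : ℝ) • X (φ x) = 0 := by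
          rw [two_smul]; nth_rewrite 1 [h2]; simp
        exact hne _ ((smul_eq_zero.1 h3).resolve_left two_ne_zero)
      have h4 := hdx.eventually_ne (c := 0) hd
      rw [eventually_nhdsWithin_iff] at h4
      obtain ⟨y, hy1, hy2⟩ := (hx.and_eventually h4).exists
      exact hy2 hy1.1 hy1.2.2
    refine (hfin1.image φ).subset ?_
    rintro z ⟨⟨t, rfl⟩, hz⟩
    obtain ⟨t', ht', he'⟩ := hper.exists_mem_Ico₀ hT t
    exact ⟨t', ⟨Set.Ico_subset_Icc_self ht', by rw [← he']; exact (hℓ _).2 hz⟩, he'.symm⟩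
  have hcl : Continuous fun r : ℝ => φ t0 + r • e := by fun_prop
  have hev : ∀ᶠ r : ℝ in 𝓝 0, dist (φ t0 + r • e) (φ t0) < δ ∧ X (φ t0 + r • e) ≠ 0 := by
    refine Filter.Eventually.and ?_ ?_
    · have h1 : Tendsto (fun r : ℝ => φ t0 + r • e) (𝓝 0) (𝓝 (φ t0)) := by
        simpa using hcl.tendsto 0
      exact h1.eventually (Metric.ball_mem_nhds _ hδ)
    · have h1 : ContinuousAt (fun r : ℝ => X (φ t0 + r • e)) 0 :=
        (hX.continuous.comp hcl).continuousAt
      exact h1.eventually_ne (by simpa using hne t0)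
  have hinf : ∃ r : ℝ, (dist (φ t0 + r • e) (φ t0) < δ ∧ X (φ t0 + r • e) ≠ 0) ∧
      φ t0 + r • e ∉ {z ∈ Set.range φ | R z = z} := by
    have hfr : {r : ℝ | φ t0 + r • e ∈ {z ∈ Set.range φ | R z = z}}.Finite := by
      refine hfin.preimage (Function.Injective.injOn ?_)
      intro r s hrs
      exact smul_left_injective ℝ he (add_left_cancel hrs)
    have hin : {r : ℝ | dist (φ t0 + r • e) (φ t0) < δ ∧ X (φ t0 + r • e) ≠ 0}.Infinite :=
      infinite_of_mem_nhds 0 hev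
    obtain ⟨r, hr1, hr2⟩ := (hin.sdiff hfr).nonempty
    exact ⟨r, hr1, hr2⟩
  obtain ⟨r, ⟨hr1, hr2⟩, hr3⟩ := hinf
  have hRz : R (φ t0 + r • e) = φ t0 + r • e := by rw [map_add, map_smul, h0, hRe]
  obtain ⟨ψ, hψ, hψ0, hψper, hψc⟩ := H _ hRz hr1
  have hψX : IsSolution X ψ := by
    intro t
    obtain ⟨s, hs⟩ := hψc t
    rw [← hYX]
    · exact hψ t
    · have h1 := (hs.trans_le (min_le_right _ _)).le
      rw [dist_eq_norm] at h1
      have h2 := norm_sub_norm_le (ψ t) (φ (s + t0))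
      linarith [hb (s + t0)]
  have hψpo : IsPeriodicOrbit X ψ := by
    refine ⟨hψX, hψper, ?_⟩
    rintro ⟨w, hw⟩
    have h1 := hψX 0
    have h2 : ψ = fun _ => w := funext hw
    have h3 : HasDerivAt ψ 0 0 := by rw [h2]; exact hasDerivAt_const _ _
    have h4 := h1.unique h3
    rw [hψ0] at h4
    exact hr2 h4
  have hrange := hiso ψ hψpo (by
    rintro _ ⟨t, rfl⟩
    obtain ⟨s, hs⟩ := hψc t
    exact hεU (Metric.mem_thickening_iff.2 ⟨_, ⟨_, rfl⟩, hs.trans_le (min_le_left _ _)⟩))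
  apply hr3
  refine ⟨?_, hRz⟩
  rw [← hrange, ← hψ0]
  exact ⟨0, rfl⟩

lemma per_const {f f' : ℝ → ℝ} (hf : ∀ t, HasDerivAt f (f' t) t) {T : ℝ} (hT : 0 < T)
    (hper : Function.Periodic f T) (h : ∀ t, 0 ≤ f' t) : ∀ t, f' t = 0 := by
  have hmono : Monotone f := monotone_of_deriv_nonneg (fun t => (hf t).differentiableAt)
    (fun t => by rw [(hf t).deriv]; exact h t)
  have hle : ∀ s t, f t ≤ f s := by
    intro s t
    obtain ⟨n, hn⟩ := exists_nat_gt ((t - s) / T)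
    have h1 : t ≤ s + n * T := by
      rw [div_lt_iff₀ hT] at hn; linarith
    have h2 : f (s + n * T) = f s := hper.nat_mul n s
    exact (hmono h1).trans h2.le
  have hc : f = fun _ => f 0 := funext fun t => le_antisymm (hle _ _) (hle _ _)
  intro t
  have h1 := hf t
  rw [hc] at h1
  exact h1.unique (hasDerivAt_const _ _)

lemma per_both {f f' : ℝ → ℝ} (hf : ∀ t, HasDerivAt f (f' t) t) {T : ℝ} (hT : 0 < T)
    (hper : Function.Periodic f T) (h : ¬ ∀ t, f' t = 0) :
    (∃ t, 0 < f' t) ∧ ∃ t, f' t < 0 := by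
  constructor
  · by_contra! hcon
    apply h
    have := per_const (f := fun t => - f t) (f' := fun t => - f' t) (fun t => (hf t).neg) hT
      (fun t => by simp [hper t]) (fun t => by linarith [hcon t])
    exact fun t => by linarith [this t]
  · by_contra! hcon
    exact h (per_const hf hT hper hcon)

lemma lin_zero {f A : ℝ → ℝ} (hA : Continuous A) (hf : ∀ t, HasDerivAt f (A t * f t) t) (t0 : ℝ)
    (h0 : f t0 = 0) (t : ℝ) : f t = 0 := by
  have hF : ∀ t, HasDerivAt (fun t => ∫ s in (0 : ℝ)..t, A s) (A t) t := fun t =>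
    (hA.integral_hasStrictDerivAt 0 t).hasDerivAt
  have hG : ∀ t, HasDerivAt (fun t => f t * Real.exp (-∫ s in (0 : ℝ)..t, A s)) 0 t := by
    intro t
    refine ((hf t).mul ((hF t).neg.exp)).congr_deriv ?_
    simp only [Pi.neg_apply]
    ring
  have := is_const_of_deriv_eq_zero (fun t => (hG t).differentiableAt) (fun t => (hG t).deriv) t t0
  simp only [h0, zero_mul] at this
  exact (mul_eq_zero.1 this).resolve_right (Real.exp_ne_zero _)

lemma const_sign {h : ℝ → ℝ} (hc : Continuous h) (hne : ∀ t, h t ≠ 0) :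
    (∀ t, 0 < h t) ∨ ∀ t, h t < 0 := by
  by_contra! hcon
  obtain ⟨⟨s, hs⟩, t, ht⟩ := hcon
  obtain ⟨u, hu⟩ := mem_range_of_exists_le_of_exists_ge hc ⟨s, hs⟩ ⟨t, ht⟩
  exact hne u hu

lemma per_cross {g g' : ℝ → ℝ} (hg : ∀ t, HasDerivAt g (g' t) t) {T : ℝ} (hT : 0 < T)
    (hper : Function.Periodic g T) (h : ∀ t, g t = 0 → 0 < g' t) (t0 : ℝ) (h0 : g t0 = 0) (t : ℝ) :
    0 ≤ g t := by
  obtain ⟨n, hn⟩ := exists_nat_gt ((t0 - t) / T)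
  have h1 : t0 ≤ t + n * T := by
    rw [div_lt_iff₀ hT] at hn; linarith
  rw [← hper.nat_mul n t]
  exact image_le_of_deriv_right_lt_deriv_boundary (f := fun _ => (0 : ℝ)) (f' := fun _ => 0)
    (a := t0) (b := t + n * T) continuousOn_const (fun x _ => hasDerivWithinAt_const _ _ _) h0.ge hg
    (fun x _ hx => h x hx.symm) ⟨h1, le_rfl⟩

lemma per_cross' {g g' : ℝ → ℝ} (hg : ∀ t, HasDerivAt g (g' t) t) {T : ℝ} (hT : 0 < T)
    (hper : Function.Periodic g T) (hp : ∃ t, 0 < g t) (hn : ∃ t, g t < 0)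
    (h : (∀ t, g t = 0 → 0 < g' t) ∨ ∀ t, g t = 0 → g' t < 0) : False := by
  have hc : Continuous g := continuous_iff_continuousAt.2 fun t => (hg t).continuousAt
  obtain ⟨s, hs⟩ := hp
  obtain ⟨r, hr⟩ := hn
  obtain ⟨t0, h0⟩ := mem_range_of_exists_le_of_exists_ge hc ⟨r, hr.le⟩ ⟨s, hs.le⟩
  rcases h with h | h
  · linarith [per_cross hg hT hper h t0 h0 r]
  · have := per_cross (g := fun t => - g t) (g' := fun t => - g' t) (fun t => (hg t).neg) hT
      (fun t => by simp [hper t]) (fun t ht => by linarith [h t (by linarith)]) t0 (by simp [h0]) s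
    linarith

/-- The vector field. -/
def VF (a b c : ℝ) (p q i j k l : ℕ) : ℝ × ℝ → ℝ × ℝ := fun z =>
  (a * z.1 ^ p * z.2 ^ q, b * z.1 ^ i * z.2 ^ j + c * z.1 ^ k * z.2 ^ l)

lemma VF_contDiff (a b c : ℝ) (p q i j k l : ℕ) : ContDiff ℝ 1 (VF a b c p q i j k l) := by
  unfold VF; fun_prop

lemma orbit_facts {a b c : ℝ} {p q i j k l : ℕ} {φ : ℝ → ℝ × ℝ}
    (h : IsPeriodicOrbit (VF a b c p q i j k l) φ) :
    a ≠ 0 ∧ Odd q ∧ (∃ t, 0 < (φ t).2) ∧ (∃ t, (φ t).2 < 0) ∧ (p ≠ 0 → ∀ t, (φ t).1 ≠ 0) := by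
  have hne := orbit_ne (VF_contDiff a b c p q i j k l) h
  obtain ⟨hs, ⟨T, hT, hper⟩, hnc⟩ := h
  have hcφ := orbit_cont hs
  have hf : ∀ t, HasDerivAt (fun t => (φ t).1) (a * (φ t).1 ^ p * (φ t).2 ^ q) t :=
    fun t => (ContinuousLinearMap.fst ℝ ℝ ℝ).hasFDerivAt.comp_hasDerivAt t (hs t)
  have hg : ∀ t, HasDerivAt (fun t => (φ t).2)
      (b * (φ t).1 ^ i * (φ t).2 ^ j + c * (φ t).1 ^ k * (φ t).2 ^ l) t :=
    fun t => (ContinuousLinearMap.snd ℝ ℝ ℝ).hasFDerivAt.comp_hasDerivAt t (hs t)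
  have hpf : Function.Periodic (fun t => (φ t).1) T := fun t => by simp [hper t]
  have hpg : Function.Periodic (fun t => (φ t).2) T := fun t => by simp [hper t]
  have hnf : ¬ ∀ t, a * (φ t).1 ^ p * (φ t).2 ^ q = 0 := by
    intro h0
    by_cases hg0 : ∀ t, b * (φ t).1 ^ i * (φ t).2 ^ j + c * (φ t).1 ^ k * (φ t).2 ^ l = 0
    · exact hne 0 (Prod.ext (h0 0) (hg0 0))
    · obtain ⟨⟨s, hs1⟩, r, hr⟩ := per_both hg hT hpg hg0
      have hc : Continuous fun t => b * (φ t).1 ^ i * (φ t).2 ^ j + c * (φ t).1 ^ k * (φ t).2 ^ l := by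
        fun_prop
      obtain ⟨t, ht⟩ := mem_range_of_exists_le_of_exists_ge hc ⟨r, hr.le⟩ ⟨s, hs1.le⟩
      exact hne t (Prod.ext (h0 t) ht)
  have ha : a ≠ 0 := by
    rintro rfl; simp at hnf
  have hfne : p ≠ 0 → ∀ t, (φ t).1 ≠ 0 := by
    intro hp t ht
    have := lin_zero (f := fun t => (φ t).1) (A := fun t => a * (φ t).1 ^ (p - 1) * (φ t).2 ^ q)
      (by fun_prop) (fun t => by
        convert hf t using 1
        obtain ⟨m, rfl⟩ := Nat.exists_eq_succ_of_ne_zero hp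
        simp only [Nat.succ_eq_add_one, Nat.add_sub_cancel]; ring) t ht
    apply hnf
    intro s
    have h3 : (φ s).1 = 0 := this s
    simp [h3, hp]
  obtain ⟨⟨t1, h1⟩, t2, h2⟩ := per_both hf hT hpf hnf
  have hu : ∀ t, a * (φ t).1 ^ p ≠ 0 := by
    intro t
    rcases eq_or_ne p 0 with rfl | hp
    · simpa using ha
    · exact mul_ne_zero ha (pow_ne_zero _ (hfne hp t))
  have hex : ∃ s1 s2, 0 < (φ s1).2 ^ q ∧ (φ s2).2 ^ q < 0 := by
    rcases const_sign (by fun_prop) hu with hp | hn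
    · exact ⟨t1, t2, pos_of_mul_pos_right h1 (hp t1).le, by
        have := hp t2; by_contra! hcon; nlinarith [mul_nonneg this.le hcon]⟩
    · exact ⟨t2, t1, by
        have := hn t2; by_contra! hcon; nlinarith [mul_nonneg_of_nonpos_of_nonpos this.le hcon], by
        have := hn t1; by_contra! hcon; nlinarith [mul_nonneg (neg_nonneg.2 this.le) hcon]⟩
  obtain ⟨s1, s2, hs1, hs2⟩ := hex
  have hq : Odd q := by
    by_contra hq
    rw [Nat.not_odd_iff_even] at hq
    linarith [hq.pow_nonneg (φ s2).2]
  exact ⟨ha, hq, ⟨s1, hq.pow_pos_iff.1 hs1⟩, ⟨s2, hq.pow_neg_iff.1 hs2⟩, hfne⟩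

lemma VF_main (a b c : ℝ) (p q i k l : ℕ) (φ : ℝ → ℝ × ℝ) :
    ¬ IsLimitCycle (VF a b c p q i 0 k l) φ := by
  intro hL
  have hX := VF_contDiff a b c p q i 0 k l
  have hpo := hL.1
  obtain ⟨ha, hq, hgp, hgn, hfne⟩ := orbit_facts hpo
  have hne := orbit_ne hX hpo
  obtain ⟨hs, ⟨T, hT, hper⟩, hnc⟩ := hpo
  have hcφ := orbit_cont hs
  have hf : ∀ t, HasDerivAt (fun t => (φ t).1) (a * (φ t).1 ^ p * (φ t).2 ^ q) t :=
    fun t => (ContinuousLinearMap.fst ℝ ℝ ℝ).hasFDerivAt.comp_hasDerivAt t (hs t)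
  have hg : ∀ t, HasDerivAt (fun t => (φ t).2)
      (b * (φ t).1 ^ i * (φ t).2 ^ 0 + c * (φ t).1 ^ k * (φ t).2 ^ l) t :=
    fun t => (ContinuousLinearMap.snd ℝ ℝ ℝ).hasFDerivAt.comp_hasDerivAt t (hs t)
  have hpf : Function.Periodic (fun t => (φ t).1) T := fun t => by simp [hper t]
  have hpg : Function.Periodic (fun t => (φ t).2) T := fun t => by simp [hper t]
  have hcg : Continuous fun t => (φ t).2 := by fun_prop
  obtain ⟨t0, ht0⟩ : ∃ t0, (φ t0).2 = 0 := by
    obtain ⟨s, hs⟩ := hgp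
    obtain ⟨r, hr⟩ := hgn
    exact mem_range_of_exists_le_of_exists_ge hcg ⟨r, hr.le⟩ ⟨s, hs.le⟩
  by_cases hA : c = 0 ∨ Even l
  ·
    let R : (ℝ × ℝ) →L[ℝ] (ℝ × ℝ) :=
      (ContinuousLinearMap.fst ℝ ℝ ℝ).prod (-(ContinuousLinearMap.snd ℝ ℝ ℝ))
    have hR : ∀ z, R z = (z.1, -z.2) := fun z => rfl
    refine rev_not_limit hX R (fun z => by simp [hR]) (fun z => by simp [hR, Prod.norm_def])
      (fun z => ?_) (ContinuousLinearMap.snd ℝ ℝ ℝ) (fun z => ?_) (1, 0) (by simp) (by simp [hR])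
      hL t0 (by ext <;> simp [hR, ht0])
    · ext
      · simp [hR, VF, hq.neg_pow]
      · rcases hA with rfl | hl
        · simp [hR, VF]
        · simp [hR, VF, hl.neg_pow]
    · simp only [hR, ContinuousLinearMap.coe_snd', Prod.ext_iff, true_and]
      constructor <;> intro h <;> linarith
  push Not at hA
  obtain ⟨hc, hl⟩ := hA
  rw [Nat.not_even_iff_odd] at hl
  have hl0 : l ≠ 0 := hl.pos.ne'
  have hb : b ≠ 0 := by
    rintro rfl
    have := lin_zero (f := fun t => (φ t).2) (A := fun t => c * (φ t).1 ^ k * (φ t).2 ^ (l - 1))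
      (by fun_prop) (fun t => by
        convert hg t using 1
        obtain ⟨m, rfl⟩ := Nat.exists_eq_succ_of_ne_zero hl0
        simp only [Nat.succ_eq_add_one, Nat.add_sub_cancel]; ring) t0 ht0
    obtain ⟨s, hs⟩ := hgp
    exact hs.ne' (this s)
  have hg0 : ∀ t, (φ t).2 = 0 →
      b * (φ t).1 ^ i * (φ t).2 ^ 0 + c * (φ t).1 ^ k * (φ t).2 ^ l = b * (φ t).1 ^ i := by
    intro t ht; simp [ht, hl0]
  obtain ⟨t1, ht1⟩ : ∃ t, (φ t).1 = 0 := by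
    by_contra! hcon
    refine per_cross' hg hT hpg hgp hgn ?_
    rcases const_sign (h := fun t => b * (φ t).1 ^ i) (by fun_prop)
      (fun t => mul_ne_zero hb (pow_ne_zero _ (hcon t))) with h | h
    · exact Or.inl fun t ht => by rw [hg0 t ht]; exact h t
    · exact Or.inr fun t ht => by rw [hg0 t ht]; exact h t
  have hp : p = 0 := by
    by_contra hp; exact hfne hp t1 ht1
  subst hp
  have hi : Odd i := by
    by_contra hi
    rw [Nat.not_odd_iff_even] at hi
    have hpos : ∀ t, (φ t).2 = 0 → 0 < (φ t).1 ^ i := by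
      intro t ht
      rcases eq_or_ne i 0 with rfl | hi0
      · simp
      · refine hi.pow_pos fun h => hne t ?_
        ext <;> simp [VF, h, ht, hi0, hl0, hq.pos.ne']
    refine per_cross' hg hT hpg hgp hgn ?_
    rcases lt_or_gt_of_ne hb with h | h
    · exact Or.inr fun t ht => by rw [hg0 t ht]; exact mul_neg_of_neg_of_pos h (hpos t ht)
    · exact Or.inl fun t ht => by rw [hg0 t ht]; exact mul_pos h (hpos t ht)
  rcases Nat.even_or_odd k with hk | hk
  ·
    have hE : ∀ t, HasDerivAt (fun t => (φ t).2 ^ (q + 1) / ((q : ℝ) + 1) * a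
        - b * ((φ t).1 ^ (i + 1) / ((i : ℝ) + 1)))
        (a * c * ((φ t).1 ^ k * (φ t).2 ^ (q + l))) t := by
      intro t
      have h1 := (((hg t).pow (q + 1)).div_const ((q : ℝ) + 1)).mul_const a
      have h2 := (((hf t).pow (i + 1)).div_const ((i : ℝ) + 1)).const_mul b
      refine (h1.sub h2).congr_deriv ?_
      have e1 : (q : ℝ) + 1 ≠ 0 := by positivity
      have e2 : (i : ℝ) + 1 ≠ 0 := by positivity
      push_cast
      field_simp
      ring
    have hEp : Function.Periodic (fun t => (φ t).2 ^ (q + 1) / ((q : ℝ) + 1) * a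
        - b * ((φ t).1 ^ (i + 1) / ((i : ℝ) + 1))) T := fun t => by simp [hper t]
    have hsgn : ∀ t, 0 ≤ (φ t).1 ^ k * (φ t).2 ^ (q + l) := fun t =>
      mul_nonneg (hk.pow_nonneg _) ((hq.add_odd hl).pow_nonneg _)
    have hz : ∀ t, a * c * ((φ t).1 ^ k * (φ t).2 ^ (q + l)) = 0 := by
      by_contra hcon
      obtain ⟨⟨s, h1⟩, r, h2⟩ := per_both hE hT hEp hcon
      rcases le_total 0 (a * c) with h | h
      · nlinarith [mul_nonneg h (hsgn r)]
      · nlinarith [mul_nonneg (neg_nonneg.2 h) (hsgn s)]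
    obtain ⟨s, hs⟩ := hgp
    have hev : ∀ᶠ t in 𝓝 s, 0 < (φ t).2 := hcg.continuousAt.eventually (lt_mem_nhds hs)
    have hev2 : (fun t => (φ t).1) =ᶠ[𝓝 s] fun _ => 0 := by
      filter_upwards [hev] with t ht
      have h1 := (mul_eq_zero.1 (hz t)).resolve_left (mul_ne_zero ha hc)
      exact eq_zero_of_pow_eq_zero ((mul_eq_zero.1 h1).resolve_right (pow_ne_zero _ ht.ne'))
    have h3 := (hf s).unique ((hasDerivAt_const s (0 : ℝ)).congr_of_eventuallyEq hev2)
    have h4 : a * (φ s).1 ^ 0 * (φ s).2 ^ q ≠ 0 := by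
      simp [ha, hs.ne']
    exact h4 h3
  ·
    let R : (ℝ × ℝ) →L[ℝ] (ℝ × ℝ) :=
      (-(ContinuousLinearMap.fst ℝ ℝ ℝ)).prod (ContinuousLinearMap.snd ℝ ℝ ℝ)
    have hR : ∀ z, R z = (-z.1, z.2) := fun z => rfl
    refine rev_not_limit hX R (fun z => by simp [hR]) (fun z => by simp [hR, Prod.norm_def])
      (fun z => ?_) (ContinuousLinearMap.fst ℝ ℝ ℝ) (fun z => ?_) (0, 1) (by simp) (by simp [hR])
      hL t1 (by ext <;> simp [hR, ht1])
    · ext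
      · simp [hR, VF]
      · simp [hR, VF, hi.neg_pow, hk.neg_pow]; ring
    · simp only [hR, ContinuousLinearMap.coe_fst', Prod.ext_iff, and_true]
      constructor <;> intro h <;> linarith

lemma VF_swap (a b c : ℝ) (p q i j k l : ℕ) :
    VF a b c p q i j k l = VF a c b p q k l i j := by
  funext z; simp [VF, add_comm]

lemma VF_final (a b c : ℝ) (p q i j k l : ℕ) (φ : ℝ → ℝ × ℝ) :
    ¬ IsLimitCycle (VF a b c p q i j k l) φ := by
  intro hL
  rcases eq_or_ne j 0 with rfl | hj
  · exact VF_main _ _ _ _ _ _ _ _ _ hL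
  rcases eq_or_ne l 0 with rfl | hl
  · rw [VF_swap] at hL
    exact VF_main _ _ _ _ _ _ _ _ _ hL
  obtain ⟨-, -, ⟨s, hs⟩, ⟨r, hr⟩, -⟩ := orbit_facts hL.1
  have hcφ := orbit_cont hL.1.1
  have hcg : Continuous fun t => (φ t).2 := by fun_prop
  obtain ⟨t0, ht0⟩ : ∃ t0, (φ t0).2 = 0 :=
    mem_range_of_exists_le_of_exists_ge hcg ⟨r, hr.le⟩ ⟨s, hs.le⟩
  have hg : ∀ t, HasDerivAt (fun t => (φ t).2)
      (b * (φ t).1 ^ i * (φ t).2 ^ j + c * (φ t).1 ^ k * (φ t).2 ^ l) t :=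
    fun t => (ContinuousLinearMap.snd ℝ ℝ ℝ).hasFDerivAt.comp_hasDerivAt t (hL.1.1 t)
  have := lin_zero (f := fun t => (φ t).2)
    (A := fun t => b * (φ t).1 ^ i * (φ t).2 ^ (j - 1) + c * (φ t).1 ^ k * (φ t).2 ^ (l - 1))
    (by fun_prop) (fun t => by
      convert hg t using 1
      obtain ⟨m, rfl⟩ := Nat.exists_eq_succ_of_ne_zero hl
      obtain ⟨n, rfl⟩ := Nat.exists_eq_succ_of_ne_zero hj
      simp only [Nat.succ_eq_add_one, Nat.add_sub_cancel]; ring) t0 ht0 s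
  exact hs.ne' this

/-- Proposition 3.6. For all reals `a, b, c` and nonnegative integers
`p, q, i, j, k, l`, the planar system `(ẋ,ẏ) = (a x^p y^q, b x^i y^j + c x^k y^l)` has no
limit cycle. -/
theorem statement7 (a b c : ℝ) (p q i j k l : ℕ) :
    ∀ φ : ℝ → ℝ × ℝ,
      ¬ IsLimitCycle
        (fun z : ℝ × ℝ =>
          ((a * z.1 ^ p * z.2 ^ q, b * z.1 ^ i * z.2 ^ j + c * z.1 ^ k * z.2 ^ l) : ℝ × ℝ))
        φ := by
  exact VF_final a b c p q i j k l
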